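/- Closed-form approximation of the endpoint derivatives: with α₊ = 1 + (h/3)·g₊, α₋ = 1 − (h/3)·g₋, β₊ = α₊ + (h²/9)·g₀·g₊, β₋ = α₋ + (h²/9)·g₀·g₋, a = (α₊·β₋ + α₋·β₊)/2, ũ = (y₊ − y₋)/h + (h/3)·(f₋·y₋ − f₊·y₊), and ṽ = (2/3)·g₀·(y₋ − y₊) − (h/3)·(4·f₀·y₀ + f₊·y₊ + f₋·y₋) + (h²/9)·g₀·(f₋·y₋ − f₊·y₊), one has: for all h ≠ 0 in some punctured neighborhood of 0, a ≠ 0, and as h → 0 through nonzero values both quantities y'₊ − (β₋·ũ + α₋·ṽ)/(2a) and y'₋ − (β₊·ũ − α₊·ṽ)/(2a), viewed as functions of h, are O(h⁴). -/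

import Mathlib

open Asymptotics Filter Topology

/-- Taylor expansion at an interior point of a convex open set, with remainder `O(h ^ (n + 1))`. -/
theorem taylor_isBigO_of_isOpen {φ : ℝ → ℝ} {s : Set ℝ} {x₀ : ℝ} (n : ℕ) (hs : Convex ℝ s)
    (ho : IsOpen s) (hx : x₀ ∈ s) (hφ : ContDiffOn ℝ (n + 1 : ℕ) φ s) :
    (fun h : ℝ => φ (x₀ + h)
        - ∑ k ∈ Finset.range (n + 1), iteratedDeriv k φ x₀ / k.factorial * h ^ k)
      =O[𝓝 0] (fun h : ℝ => h ^ (n + 1)) := by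
  have taylor := (taylor_isLittleO hs hx hφ).isBigO
  rw [ho.nhdsWithin_eq hx] at taylor
  have shift : Tendsto (fun h : ℝ => x₀ + h) (𝓝 0) (𝓝 x₀) :=
    Continuous.tendsto' (by fun_prop) _ _ (add_zero x₀)
  have shifted := (taylor.comp_tendsto shift).congr_right (g₂ := fun h : ℝ => h ^ (n + 1))
    (fun h => by simp)
  have top : (fun h : ℝ => iteratedDeriv (n + 1) φ x₀ / (n + 1).factorial * h ^ (n + 1))
      =O[𝓝 0] (fun h : ℝ => h ^ (n + 1)) :=
    (isBigO_refl _ _).const_mul_left _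
  refine (shifted.add top).congr_left fun h => ?_
  simp only [Function.comp_apply, taylor_within_apply, add_sub_cancel_left, smul_eq_mul,
    iteratedDerivWithin_of_isOpen ho hx]
  rw [Finset.sum_range_succ _ (n + 1)]
  have coeff : ∀ k : ℕ, (k.factorial : ℝ)⁻¹ * h ^ k * iteratedDeriv k φ x₀
      = iteratedDeriv k φ x₀ / k.factorial * h ^ k := fun k => by ring
  simp only [coeff]
  ring

/-- Compatible Taylor expansions of a `C⁵` function and of its first two derivatives. -/
theorem exists_taylor_expansions {y : ℝ → ℝ} {s : Set ℝ} {x₀ : ℝ} (hs : Convex ℝ s)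
    (ho : IsOpen s) (hx : x₀ ∈ s) (hy : ContDiffOn ℝ 5 y s) :
    ∃ c d : ℝ,
      (fun h : ℝ => y (x₀ + h) - (y x₀ + deriv y x₀ * h + deriv (deriv y) x₀ / 2 * h ^ 2
        + c / 6 * h ^ 3 + d / 24 * h ^ 4)) =O[𝓝 0] (fun h : ℝ => h ^ 5) ∧
      (fun h : ℝ => deriv y (x₀ + h) - (deriv y x₀ + deriv (deriv y) x₀ * h
        + c / 2 * h ^ 2 + d / 6 * h ^ 3)) =O[𝓝 0] (fun h : ℝ => h ^ 4) ∧
      (fun h : ℝ => deriv (deriv y) (x₀ + h) - (deriv (deriv y) x₀ + c * h + d / 2 * h ^ 2))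
        =O[𝓝 0] (fun h : ℝ => h ^ 3) := by
  have hy₁ : ContDiffOn ℝ 4 (deriv y) s := hy.deriv_of_isOpen ho (by norm_num)
  have hy₂ : ContDiffOn ℝ 3 (deriv (deriv y)) s := hy₁.deriv_of_isOpen ho (by norm_num)
  refine ⟨iteratedDeriv 3 y x₀, iteratedDeriv 4 y x₀, ?_, ?_, ?_⟩
  · refine (taylor_isBigO_of_isOpen 4 hs ho hx hy).congr_left fun h => ?_
    simp [Finset.sum_range_succ, iteratedDeriv_succ', Nat.factorial]
  · refine (taylor_isBigO_of_isOpen 3 hs ho hx hy₁).congr_left fun h => ?_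
    simp [Finset.sum_range_succ, iteratedDeriv_succ', Nat.factorial]
  · refine (taylor_isBigO_of_isOpen 2 hs ho hx hy₂).congr_left fun h => ?_
    simp [Finset.sum_range_succ, iteratedDeriv_succ', Nat.factorial]

/-- A bound `O(h ^ n)` at `0` is preserved by the reflection `h ↦ -h`. -/
theorem isBigO_pow_comp_neg {r : ℝ → ℝ} {n : ℕ} (hr : r =O[𝓝 0] (fun h : ℝ => h ^ n)) :
    (fun h : ℝ => r (-h)) =O[𝓝 0] (fun h : ℝ => h ^ n) := by
  have reflect : Tendsto (fun h : ℝ => -h) (𝓝 0) (𝓝 0) :=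
    Continuous.tendsto' (by fun_prop) _ _ neg_zero
  refine (hr.comp_tendsto reflect).trans (isBigO_of_le _ fun h => ?_)
  simp

section Quadrature

variable {y : ℝ → ℝ} {s : Set ℝ} {x₀ : ℝ}

/-- The sum of the endpoint derivatives from second derivatives and a central difference. -/
theorem endpoint_deriv_add_isBigO (hs : Convex ℝ s) (ho : IsOpen s) (hx : x₀ ∈ s)
    (hy : ContDiffOn ℝ 5 y s) :
    (fun h : ℝ => deriv y (x₀ + h) + deriv y (x₀ - h)
        - h / 3 * (deriv (deriv y) (x₀ + h) - deriv (deriv y) (x₀ - h))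
        - (y (x₀ + h) - y (x₀ - h)) / h) =O[𝓝[≠] 0] (fun h : ℝ => h ^ 4) := by
  obtain ⟨c, d, h₀, h₁, h₂⟩ := exists_taylor_expansions hs ho hx hy
  have b₁ := h₁.add (isBigO_pow_comp_neg h₁)
  have b₂ := ((isBigO_refl (fun h : ℝ => h) (𝓝 0)).mul
    (h₂.sub (isBigO_pow_comp_neg h₂))).const_mul_left (1 / 3)
  have b₀ := (isBigO_refl (fun h : ℝ => h⁻¹) (𝓝[≠] 0)).mul
    ((h₀.sub (isBigO_pow_comp_neg h₀)).mono nhdsWithin_le_nhds)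
  have b₀' := b₀.congr' (g₂ := fun h : ℝ => h ^ 4) EventuallyEq.rfl <| by
    filter_upwards [self_mem_nhdsWithin] with h hh
    have : h ≠ 0 := hh
    field_simp
  have b₂' := b₂.congr_right (g₂ := fun h : ℝ => h ^ 4) fun h => by ring
  refine (((b₁.sub b₂').mono nhdsWithin_le_nhds).sub b₀').congr' ?_ EventuallyEq.rfl
  filter_upwards [self_mem_nhdsWithin] with h hh
  have : h ≠ 0 := hh
  simp only [← sub_eq_add_neg x₀]
  field_simp
  ring

/-- Simpson's rule for the increment of the derivative. -/
theorem endpoint_deriv_sub_isBigO (hs : Convex ℝ s) (ho : IsOpen s) (hx : x₀ ∈ s)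
    (hy : ContDiffOn ℝ 5 y s) :
    (fun h : ℝ => deriv y (x₀ + h) - deriv y (x₀ - h) - h / 3 *
        (deriv (deriv y) (x₀ + h) + 4 * deriv (deriv y) x₀ + deriv (deriv y) (x₀ - h)))
      =O[𝓝 0] (fun h : ℝ => h ^ 4) := by
  obtain ⟨c, d, -, h₁, h₂⟩ := exists_taylor_expansions hs ho hx hy
  have b₁ := h₁.sub (isBigO_pow_comp_neg h₁)
  have b₂ := ((isBigO_refl (fun h : ℝ => h) (𝓝 0)).mul
    (h₂.add (isBigO_pow_comp_neg h₂))).const_mul_left (1 / 3)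
  have b₂' := b₂.congr_right (g₂ := fun h : ℝ => h ^ 4) fun h => by ring
  refine (b₁.sub b₂').congr_left fun h => ?_
  simp only [← sub_eq_add_neg x₀]
  ring

/-- The midpoint derivative from a central difference and second derivatives. -/
theorem midpoint_deriv_isBigO (hs : Convex ℝ s) (ho : IsOpen s) (hx : x₀ ∈ s)
    (hy : ContDiffOn ℝ 5 y s) :
    (fun h : ℝ => 2 / 3 * (y (x₀ + h) - y (x₀ - h))
        - h ^ 2 / 9 * (deriv (deriv y) (x₀ + h) - deriv (deriv y) (x₀ - h))
        - 4 * h / 3 * deriv y x₀) =O[𝓝 0] (fun h : ℝ => h ^ 5) := by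
  obtain ⟨c, d, h₀, -, h₂⟩ := exists_taylor_expansions hs ho hx hy
  have b₀ := (h₀.sub (isBigO_pow_comp_neg h₀)).const_mul_left (2 / 3)
  have b₂ := ((isBigO_refl (fun h : ℝ => h ^ 2) (𝓝 0)).mul
    (h₂.sub (isBigO_pow_comp_neg h₂))).const_mul_left (1 / 9)
  have b₂' := b₂.congr_right (g₂ := fun h : ℝ => h ^ 5) fun h => by ring
  refine (b₀.sub b₂').congr_left fun h => ?_
  simp only [← sub_eq_add_neg x₀]
  ring

end Quadrature

/-- If `b` and `c` are bounded and `a → 1`, dividing a combination of `O(e)` terms by `2 * a`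
leaves an `O(e)` term. -/
theorem isBigO_combination_div {l : Filter ℝ} {a b c r t e : ℝ → ℝ} {b₀ c₀ : ℝ}
    (ha : Tendsto a l (𝓝 1)) (hb : Tendsto b l (𝓝 b₀)) (hc : Tendsto c l (𝓝 c₀))
    (hr : r =O[l] e) (ht : t =O[l] e) :
    (fun h => (b h * r h + c h * t h) / (2 * a h)) =O[l] e := by
  have inv : Tendsto (fun h => (2 * a h)⁻¹) l (𝓝 (2 * 1)⁻¹) :=
    (ha.const_mul 2).inv₀ (by norm_num)
  have hbr := (hb.isBigO_one ℝ).mul hr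
  have hct := (hc.isBigO_one ℝ).mul ht
  simpa [div_eq_mul_inv] using (hbr.add hct).mul (inv.isBigO_one ℝ)

/-- Closed-form approximation of the endpoint derivatives: `a(h) ≠ 0` in a punctured
neighborhood of `0`, and both `y'₊ − (β₋ũ + α₋ṽ)/(2a)` and `y'₋ − (β₊ũ − α₊ṽ)/(2a)`
are `O(h⁴)` as `h → 0` through nonzero values. -/
theorem closed_form_endpoint_derivatives
    (x₀ lo hi : ℝ) (y g f : ℝ → ℝ)
    (hx : x₀ ∈ Set.Ioo lo hi)
    (hy : ContDiffOn ℝ 8 y (Set.Ioo lo hi))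
    (hg : ContDiffOn ℝ 8 g (Set.Ioo lo hi))
    (hf : ContDiffOn ℝ 8 f (Set.Ioo lo hi))
    (hode : ∀ x ∈ Set.Ioo lo hi,
      deriv (deriv y) x + g x * deriv y x + f x * y x = 0) :
    (∀ᶠ h : ℝ in 𝓝[≠] 0,
      (1 + (h / 3) * g (x₀ + h)) * (1 - (h / 3) * g (x₀ - h) + (h ^ 2 / 9) * g x₀ * g (x₀ - h)) / 2
        + (1 - (h / 3) * g (x₀ - h)) * (1 + (h / 3) * g (x₀ + h) + (h ^ 2 / 9) * g x₀ * g (x₀ + h)) / 2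
        ≠ 0)
    ∧ ((fun h : ℝ =>
        let αp := 1 + (h / 3) * g (x₀ + h)
        let αm := 1 - (h / 3) * g (x₀ - h)
        let βp := αp + (h ^ 2 / 9) * g x₀ * g (x₀ + h)
        let βm := αm + (h ^ 2 / 9) * g x₀ * g (x₀ - h)
        let a := (αp * βm + αm * βp) / 2
        let u := (y (x₀ + h) - y (x₀ - h)) / h
          + (h / 3) * (f (x₀ - h) * y (x₀ - h) - f (x₀ + h) * y (x₀ + h))
        let v := (2 / 3) * g x₀ * (y (x₀ - h) - y (x₀ + h))
          - (h / 3) * (4 * f x₀ * y x₀ + f (x₀ + h) * y (x₀ + h) + f (x₀ - h) * y (x₀ - h))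
          + (h ^ 2 / 9) * g x₀ * (f (x₀ - h) * y (x₀ - h) - f (x₀ + h) * y (x₀ + h))
        deriv y (x₀ + h) - (βm * u + αm * v) / (2 * a))
        =O[𝓝[≠] 0] (fun h : ℝ => h ^ 4))
    ∧ ((fun h : ℝ =>
        let αp := 1 + (h / 3) * g (x₀ + h)
        let αm := 1 - (h / 3) * g (x₀ - h)
        let βp := αp + (h ^ 2 / 9) * g x₀ * g (x₀ + h)
        let βm := αm + (h ^ 2 / 9) * g x₀ * g (x₀ - h)
        let a := (αp * βm + αm * βp) / 2
        let u := (y (x₀ + h) - y (x₀ - h)) / h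
          + (h / 3) * (f (x₀ - h) * y (x₀ - h) - f (x₀ + h) * y (x₀ + h))
        let v := (2 / 3) * g x₀ * (y (x₀ - h) - y (x₀ + h))
          - (h / 3) * (4 * f x₀ * y x₀ + f (x₀ + h) * y (x₀ + h) + f (x₀ - h) * y (x₀ - h))
          + (h ^ 2 / 9) * g x₀ * (f (x₀ - h) * y (x₀ - h) - f (x₀ + h) * y (x₀ + h))
        deriv y (x₀ - h) - (βp * u - αp * v) / (2 * a))
        =O[𝓝[≠] 0] (fun h : ℝ => h ^ 4)) := by
  have ho : IsOpen (Set.Ioo lo hi) := isOpen_Ioo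
  have hs : Convex ℝ (Set.Ioo lo hi) := convex_Ioo lo hi
  have hy₅ : ContDiffOn ℝ 5 y (Set.Ioo lo hi) := hy.of_le (by norm_num)
  have plus : Tendsto (fun h : ℝ => x₀ + h) (𝓝[≠] 0) (𝓝 x₀) :=
    (Continuous.tendsto' (by fun_prop) _ _ (add_zero x₀)).mono_left nhdsWithin_le_nhds
  have minus : Tendsto (fun h : ℝ => x₀ - h) (𝓝[≠] 0) (𝓝 x₀) :=
    (Continuous.tendsto' (by fun_prop) _ _ (sub_zero x₀)).mono_left nhdsWithin_le_nhds
  have hid : Tendsto (fun h : ℝ => h) (𝓝[≠] 0) (𝓝 0) := nhdsWithin_le_nhds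
  have g_cont : Tendsto g (𝓝 x₀) (𝓝 (g x₀)) := hg.continuousOn.continuousAt (ho.mem_nhds hx)
  have gp := g_cont.comp plus
  have gm := g_cont.comp minus
  have lin_p : Tendsto (fun h : ℝ => 1 + (h / 3) * g (x₀ + h)) (𝓝[≠] 0) (𝓝 1) := by
    simpa using ((hid.div_const 3).mul gp).const_add 1
  have lin_m : Tendsto (fun h : ℝ => 1 - (h / 3) * g (x₀ - h)) (𝓝[≠] 0) (𝓝 1) := by
    simpa using ((hid.div_const 3).mul gm).const_sub 1
  have quad_p : Tendsto (fun h : ℝ => 1 + (h / 3) * g (x₀ + h)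
      + (h ^ 2 / 9) * g x₀ * g (x₀ + h)) (𝓝[≠] 0) (𝓝 1) := by
    simpa using lin_p.add ((((hid.pow 2).div_const 9).mul_const (g x₀)).mul gp)
  have quad_m : Tendsto (fun h : ℝ => 1 - (h / 3) * g (x₀ - h)
      + (h ^ 2 / 9) * g x₀ * g (x₀ - h)) (𝓝[≠] 0) (𝓝 1) := by
    simpa using lin_m.add ((((hid.pow 2).div_const 9).mul_const (g x₀)).mul gm)
  have det : Tendsto (fun h : ℝ => ((1 + (h / 3) * g (x₀ + h))
      * (1 - (h / 3) * g (x₀ - h) + (h ^ 2 / 9) * g x₀ * g (x₀ - h))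
      + (1 - (h / 3) * g (x₀ - h))
      * (1 + (h / 3) * g (x₀ + h) + (h ^ 2 / 9) * g x₀ * g (x₀ + h))) / 2) (𝓝[≠] 0) (𝓝 1) := by
    have := ((lin_p.mul quad_m).add (lin_m.mul quad_p)).div_const 2
    norm_num at this ⊢
    exact this
  have det_ne := det.eventually_ne one_ne_zero
  have ode₀ := hode x₀ hx
  have ode_p : ∀ᶠ h : ℝ in 𝓝[≠] 0, deriv (deriv y) (x₀ + h)
      = -(g (x₀ + h) * deriv y (x₀ + h)) - f (x₀ + h) * y (x₀ + h) := by
    filter_upwards [plus.eventually (ho.mem_nhds hx)] with h hh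
    linarith [hode _ hh]
  have ode_m : ∀ᶠ h : ℝ in 𝓝[≠] 0, deriv (deriv y) (x₀ - h)
      = -(g (x₀ - h) * deriv y (x₀ - h)) - f (x₀ - h) * y (x₀ - h) := by
    filter_upwards [minus.eventually (ho.mem_nhds hx)] with h hh
    linarith [hode _ hh]
  have sum_res := endpoint_deriv_add_isBigO hs ho hx hy₅
  have mid_res := (midpoint_deriv_isBigO hs ho hx hy₅).trans
    (isLittleO_pow_pow (𝕜 := ℝ) (show 4 < 5 by norm_num)).isBigO
  have diff_res := ((endpoint_deriv_sub_isBigO hs ho hx hy₅).add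
    (mid_res.const_mul_left (g x₀))).mono (nhdsWithin_le_nhds (s := {0}ᶜ))
  refine ⟨det_ne.mono fun h hh => by rwa [← add_div], ?_, ?_⟩
  · refine (isBigO_combination_div det quad_m lin_m sum_res diff_res).congr' ?_ EventuallyEq.rfl
    filter_upwards [det_ne, ode_p, ode_m] with h hdet hp hm
    rw [eq_sub_iff_add_eq, ← add_div, div_eq_iff (mul_ne_zero two_ne_zero hdet), hp, hm]
    linear_combination (-4 * h / 3) * (1 - (h / 3) * g (x₀ - h)) * ode₀
  · refine (isBigO_combination_div det quad_p (lin_p.neg) sum_res diff_res).congr' ?_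
      EventuallyEq.rfl
    filter_upwards [det_ne, ode_p, ode_m] with h hdet hp hm
    rw [eq_sub_iff_add_eq, ← add_div, div_eq_iff (mul_ne_zero two_ne_zero hdet), hp, hm]
    linear_combination (4 * h / 3) * (1 + (h / 3) * g (x₀ + h)) * ode₀
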